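/- Let β₁ = e^{−λ_max(A)} and β₂ = e^{λ_max(A)}. Then β₁ = sup{β > 0 : λ_μ(F_β,0) < 0 for all g-invariant Borel probability measures μ on Θ×𝕋} and β₂ = inf{β > 0 : λ_μ(F_β,0) > 0 for all g-invariant Borel probability measures μ on Θ×𝕋}. -/

import Mathlib

open Filter MeasureTheory Metric Set
open scoped Topology

noncomputable section

/-- ℝ² with the Euclidean norm. -/
abbrev R2 : Type := EuclideanSpace ℝ (Fin 2)

/-- Action of a 2×2 real matrix on Euclidean ℝ². -/
def mulVecE (M : Matrix (Fin 2) (Fin 2) ℝ) (v : R2) : R2 :=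
  (WithLp.equiv 2 (Fin 2 → ℝ)).symm (M.mulVec ((WithLp.equiv 2 (Fin 2 → ℝ)) v))

/-- Operator norm of a 2×2 real matrix induced by the Euclidean norm on ℝ². -/
def opNorm (M : Matrix (Fin 2) (Fin 2) ℝ) : ℝ :=
  ‖(Matrix.toEuclideanCLM (𝕜 := ℝ) M : R2 →L[ℝ] R2)‖

/-- The cocycle `A_n(θ) = A(γ^{n-1}θ) ⋯ A(θ)`. -/
def coc {Θ : Type*} (γ : Θ → Θ) (A : Θ → Matrix (Fin 2) (Fin 2) ℝ) :
    ℕ → Θ → Matrix (Fin 2) (Fin 2) ℝ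
  | 0, _ => 1
  | n + 1, θ => coc γ A n (γ θ) * A θ

/-- Maximal Lyapunov exponent `λ_max(A) = sup_θ limsup (1/n) log‖A_n(θ)‖`. -/
def lyapMax {Θ : Type*} (γ : Θ → Θ) (A : Θ → Matrix (Fin 2) (Fin 2) ℝ) : ℝ :=
  ⨆ θ : Θ, Filter.limsup (fun n : ℕ => Real.log (opNorm (coc γ A n θ)) / n) Filter.atTop

/-- The hypotheses on `h`: C² on [0,∞), strictly increasing, strictly concave, bounded,
nonnegative, `h 0 = 0`, `h' 0 = 1`. -/
def GoodH (h : ℝ → ℝ) : Prop :=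
  ContDiffOn ℝ 2 h (Set.Ici 0) ∧ StrictMonoOn h (Set.Ici 0) ∧
    StrictConcaveOn ℝ (Set.Ici 0) h ∧ BddAbove (h '' Set.Ici 0) ∧
    (∀ x ∈ Set.Ici (0 : ℝ), 0 ≤ h x) ∧ h 0 = 0 ∧ derivWithin h (Set.Ici 0) 0 = 1

/-- The scaling condition `sup_{x ≥ 0} h(x) ≤ (sup_θ ‖A(θ)‖)⁻¹`. -/
def Scaled {Θ : Type*} (A : Θ → Matrix (Fin 2) (Fin 2) ℝ) (h : ℝ → ℝ) : Prop :=
  ∀ x ∈ Set.Ici (0 : ℝ), h x ≤ (⨆ θ : Θ, opNorm (A θ))⁻¹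

open scoped Classical in
/-- The fibre maps `f_{β,θ}(v) = h(β‖v‖)·A(θ)·v/‖v‖`, `f_{β,θ}(0) = 0`. -/
def fibMap {Θ : Type*} (A : Θ → Matrix (Fin 2) (Fin 2) ℝ) (h : ℝ → ℝ) (β : ℝ)
    (θ : Θ) (v : R2) : R2 :=
  if v = 0 then 0 else (h (β * ‖v‖) / ‖v‖) • mulVecE (A θ) v

/-- The skew product `f_β(θ,v) = (γθ, f_{β,θ}(v))`. -/
def skewProd {Θ : Type*} (γ : Θ → Θ) (A : Θ → Matrix (Fin 2) (Fin 2) ℝ) (h : ℝ → ℝ)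
    (β : ℝ) : Θ × R2 → Θ × R2 :=
  fun p => (γ p.1, fibMap A h β p.1 p.2)

/-- The global attractor `𝒜_β = ⋂_{n∈ℕ} f_β^n(Θ × B̄₁(0))`. -/
def globalAttractor {Θ : Type*} (γ : Θ → Θ) (A : Θ → Matrix (Fin 2) (Fin 2) ℝ)
    (h : ℝ → ℝ) (β : ℝ) : Set (Θ × R2) :=
  ⋂ n : ℕ, (skewProd γ A h β)^[n] '' (Set.univ ×ˢ Metric.closedBall (0 : R2) 1)

/-- The fibre `𝒜_β(θ) = {x : (θ,x) ∈ 𝒜_β}` of the global attractor. -/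
def attractorFib {Θ : Type*} (γ : Θ → Θ) (A : Θ → Matrix (Fin 2) (Fin 2) ℝ)
    (h : ℝ → ℝ) (β : ℝ) (θ : Θ) : Set R2 :=
  {x : R2 | (θ, x) ∈ globalAttractor γ A h β}

/-- `v(α) = (cos 2πα, sin 2πα)ᵗ`. -/
def vFull (α : ℝ) : R2 :=
  (WithLp.equiv 2 (Fin 2 → ℝ)).symm ![Real.cos (2 * Real.pi * α), Real.sin (2 * Real.pi * α)]

/-- `(cos πα, sin πα)ᵗ`, representing the projective point `α ∈ 𝕋 ≅ ℝP¹`. -/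
def vHalf (α : ℝ) : R2 :=
  (WithLp.equiv 2 (Fin 2 → ℝ)).symm ![Real.cos (Real.pi * α), Real.sin (Real.pi * α)]

/-- The projective angle coordinate `p(w) = (1/π)·arg(w) mod 1 ∈ [0,1)` of a nonzero
vector `w ∈ ℝ²`; for `w ≠ 0` this equals `(1/π)·arctan(w₂/w₁) mod 1`. -/
def projAngle (w : R2) : ℝ :=
  Int.fract (Complex.arg (Complex.ofReal (w 0) + Complex.ofReal (w 1) * Complex.I) / Real.pi)

/-- The projective action `g(θ,α) = (γθ, g_θ(α))` of the cocycle on `Θ × 𝕋`,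
where `𝕋` is modelled by the fundamental domain `[0,1) ⊆ ℝ`. -/
def gMap {Θ : Type*} (γ : Θ → Θ) (A : Θ → Matrix (Fin 2) (Fin 2) ℝ) :
    Θ × ℝ → Θ × ℝ :=
  fun p => (γ p.1, projAngle (mulVecE (A p.1) (vHalf p.2)))

/-- `Ω(θ,α) = ‖A(θ)(cos πα, sin πα)ᵗ‖`. -/
def Omega {Θ : Type*} (A : Θ → Matrix (Fin 2) (Fin 2) ℝ) (p : Θ × ℝ) : ℝ :=
  ‖mulVecE (A p.1) (vHalf p.2)‖

/-- The fibre maps `F_{β,θ,α}(r) = h(βr)·Ω(θ,α)` of the double skew product. -/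
def dsFib {Θ : Type*} (A : Θ → Matrix (Fin 2) (Fin 2) ℝ) (h : ℝ → ℝ) (β : ℝ)
    (p : Θ × ℝ) (r : ℝ) : ℝ :=
  h (β * r) * Omega A p

/-- The double skew product `F_β(θ,α,r) = (g(θ,α), h(βr)·Ω(θ,α))` on `Θ × 𝕋 × [0,∞)`. -/
def dsMap {Θ : Type*} (γ : Θ → Θ) (A : Θ → Matrix (Fin 2) (Fin 2) ℝ) (h : ℝ → ℝ)
    (β : ℝ) : Θ × ℝ × ℝ → Θ × ℝ × ℝ :=
  fun p => ((gMap γ A (p.1, p.2.1)).1, (gMap γ A (p.1, p.2.1)).2, dsFib A h β (p.1, p.2.1) p.2.2)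

/-- `Ω_n(θ,α) = ∏_{i=0}^{n-1} Ω(g^i(θ,α))`. -/
def OmegaProd {Θ : Type*} (γ : Θ → Θ) (A : Θ → Matrix (Fin 2) (Fin 2) ℝ) (n : ℕ)
    (p : Θ × ℝ) : ℝ :=
  ∏ i ∈ Finset.range n, Omega A ((gMap γ A)^[i] p)

/-- `Γ(a,b) = inf_{a ≤ x ≤ 1} inf_{0 < q ≤ b} h(qx)/(q·h(x))`. -/
def GammaH (h : ℝ → ℝ) (a b : ℝ) : ℝ :=
  sInf {y : ℝ | ∃ x ∈ Set.Icc a 1, ∃ q ∈ Set.Ioc (0 : ℝ) b, y = h (q * x) / (q * h x)}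

/-- The inverse `g⁻¹(θ,α) = (γ⁻¹θ, projective angle of A(γ⁻¹θ)⁻¹·v(α))` of the
projective action. -/
def gInv {Θ : Type*} (γinv : Θ → Θ) (A : Θ → Matrix (Fin 2) (Fin 2) ℝ) :
    Θ × ℝ → Θ × ℝ :=
  fun p => (γinv p.1, projAngle (mulVecE (A (γinv p.1))⁻¹ (vHalf p.2)))

/-- `F^n_{β,g^{-n}(θ,α)}(1)`, the pullback iterate defining the upper bounding graph. -/
def pullback1 {Θ : Type*} (γ : Θ → Θ) (γinv : Θ → Θ) (A : Θ → Matrix (Fin 2) (Fin 2) ℝ)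
    (h : ℝ → ℝ) (β : ℝ) (n : ℕ) (p : Θ × ℝ) : ℝ :=
  ((dsMap γ A h β)^[n] (((gInv γinv A)^[n] p).1, ((gInv γinv A)^[n] p).2, 1)).2.2

/-! ### Linear algebra in the Euclidean plane -/

theorem mulVecE_eq (M : Matrix (Fin 2) (Fin 2) ℝ) (v : R2) :
    mulVecE M v = Matrix.toEuclideanCLM (𝕜 := ℝ) M v := rfl

theorem mulVecE_smul (M : Matrix (Fin 2) (Fin 2) ℝ) (c : ℝ) (v : R2) :
    mulVecE M (c • v) = c • mulVecE M v := by
  simp [mulVecE_eq]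

theorem mulVecE_mul (M N : Matrix (Fin 2) (Fin 2) ℝ) (v : R2) :
    mulVecE (M * N) v = mulVecE M (mulVecE N v) := by
  simp [mulVecE_eq]

theorem norm_mulVecE_le (M : Matrix (Fin 2) (Fin 2) ℝ) (v : R2) :
    ‖mulVecE M v‖ ≤ opNorm M * ‖v‖ :=
  (Matrix.toEuclideanCLM (𝕜 := ℝ) M : R2 →L[ℝ] R2).le_opNorm v

theorem continuous_toEuclideanCLM : Continuous fun M : Matrix (Fin 2) (Fin 2) ℝ =>
    (Matrix.toEuclideanCLM (𝕜 := ℝ) M : R2 →L[ℝ] R2) :=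
  LinearMap.continuous_of_finiteDimensional
    (Matrix.toEuclideanCLM (𝕜 := ℝ) (n := Fin 2)).toAlgEquiv.toLinearMap

theorem continuous_opNorm : Continuous opNorm :=
  continuous_toEuclideanCLM.norm

theorem norm_le_opNorm_mul_of_det_eq_one {M : Matrix (Fin 2) (Fin 2) ℝ} (hM : M.det = 1)
    (v : R2) : ‖v‖ ≤ opNorm M * ‖mulVecE M v‖ := by
  rcases eq_or_ne v 0 with rfl | hv
  · simp [mulVecE_eq]
  let w : R2 := !₂[-v 1, v 0]
  have hw : ‖w‖ = ‖v‖ := by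
    simp [w, EuclideanSpace.norm_eq, Fin.sum_univ_two, add_comm]
  have hsq (u : R2) : ‖u‖ ^ 2 = u 0 ^ 2 + u 1 ^ 2 := by
    simp [EuclideanSpace.norm_sq_eq, Fin.sum_univ_two]
  have hcross : mulVecE M v 0 * mulVecE M w 1 - mulVecE M v 1 * mulVecE M w 0 = ‖v‖ ^ 2 := by
    rw [Matrix.det_fin_two] at hM
    rw [hsq]
    simp only [mulVecE, Matrix.mulVec, dotProduct, Fin.sum_univ_two, WithLp.equiv_symm_apply,
      WithLp.equiv_apply, w, Matrix.cons_val_zero, Matrix.cons_val_one]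
    linear_combination (v 0 ^ 2 + v 1 ^ 2) * hM
  have hcs : ‖v‖ ^ 2 ≤ ‖mulVecE M v‖ * ‖mulVecE M w‖ := by
    refine abs_le_of_sq_le_sq' ?_ (by positivity) |>.2
    rw [mul_pow, hsq (mulVecE M v), hsq (mulVecE M w), ← hcross]
    nlinarith [sq_nonneg (mulVecE M v 0 * mulVecE M w 0 + mulVecE M v 1 * mulVecE M w 1)]
  have hwle := norm_mulVecE_le M w
  rw [hw] at hwle
  have hv' : 0 < ‖v‖ := norm_pos_iff.2 hv
  refine le_of_mul_le_mul_right ?_ hv'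
  calc ‖v‖ * ‖v‖ = ‖v‖ ^ 2 := (sq _).symm
    _ ≤ ‖mulVecE M v‖ * ‖mulVecE M w‖ := hcs
    _ ≤ ‖mulVecE M v‖ * (opNorm M * ‖v‖) := by gcongr
    _ = opNorm M * ‖mulVecE M v‖ * ‖v‖ := by ring

theorem one_le_opNorm_of_det_eq_one {M : Matrix (Fin 2) (Fin 2) ℝ} (hM : M.det = 1) :
    1 ≤ opNorm M := by
  have h := norm_le_opNorm_mul_of_det_eq_one hM (EuclideanSpace.single 0 1)
  have h' := norm_mulVecE_le M (EuclideanSpace.single 0 1)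
  have h0 : 0 ≤ opNorm M := norm_nonneg _
  simp only [PiLp.norm_single, norm_one, mul_one] at h h'
  nlinarith

theorem mulVecE_ne_zero {M : Matrix (Fin 2) (Fin 2) ℝ} (hM : M.det = 1) {v : R2} (hv : v ≠ 0) :
    mulVecE M v ≠ 0 := by
  intro h
  have := norm_le_opNorm_mul_of_det_eq_one hM v
  rw [h, norm_zero, mul_zero] at this
  exact hv (norm_le_zero_iff.1 this)

theorem exists_norm_mulVecE_eq_opNorm (M : Matrix (Fin 2) (Fin 2) ℝ) :
    ∃ v : R2, ‖v‖ = 1 ∧ ‖mulVecE M v‖ = opNorm M := by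
  obtain ⟨v, hv, hmax⟩ := (isCompact_sphere (0 : R2) 1).exists_isMaxOn
    (NormedSpace.sphere_nonempty.2 zero_le_one)
    (f := fun v => ‖Matrix.toEuclideanCLM (𝕜 := ℝ) M v‖) (by fun_prop)
  have hv1 : ‖v‖ = 1 := by simpa using hv
  refine ⟨v, hv1, le_antisymm (by simpa [hv1] using norm_mulVecE_le M v) ?_⟩
  refine ContinuousLinearMap.opNorm_le_of_unit_norm (norm_nonneg _) fun u hu => ?_
  exact hmax (by simpa using hu)

theorem exists_opNorm_mul_norm_mulVecE_le {M : Matrix (Fin 2) (Fin 2) ℝ} (hM : M.det = 1) :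
    ∃ v : R2, ‖v‖ = 1 ∧ opNorm M * ‖mulVecE M v‖ ≤ 1 := by
  have hu : IsUnit M.det := by simp [hM]
  have hinv : (M⁻¹).det = 1 := by simp [Matrix.det_nonsing_inv, hM]
  obtain ⟨u, hu1, hu2⟩ := exists_norm_mulVecE_eq_opNorm M
  obtain ⟨x, hx1, hx2⟩ := exists_norm_mulVecE_eq_opNorm M⁻¹
  have hle : opNorm M ≤ opNorm M⁻¹ := by
    have := norm_le_opNorm_mul_of_det_eq_one hinv (mulVecE M u)
    rwa [← mulVecE_mul, Matrix.nonsing_inv_mul M hu, hu2, mulVecE_eq, map_one,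
      one_apply_eq_self, hu1, mul_one] at this
  have hpos : 0 < opNorm M⁻¹ := one_pos.trans_le (one_le_opNorm_of_det_eq_one hinv)
  refine ⟨(opNorm M⁻¹)⁻¹ • mulVecE M⁻¹ x, ?_, ?_⟩
  · rw [norm_smul, hx2, norm_inv, Real.norm_of_nonneg hpos.le, inv_mul_cancel₀ hpos.ne']
  · rw [mulVecE_smul, ← mulVecE_mul, Matrix.mul_nonsing_inv M hu, mulVecE_eq, map_one,
      one_apply_eq_self, norm_smul, hx1, mul_one, norm_inv,
      Real.norm_of_nonneg hpos.le, ← div_eq_mul_inv]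
    exact (div_le_one hpos).2 hle

/-! ### The projective angle -/

theorem norm_vHalf (α : ℝ) : ‖vHalf α‖ = 1 := by
  simp [vHalf, EuclideanSpace.norm_eq, Fin.sum_univ_two]

theorem vHalf_ne_zero (α : ℝ) : vHalf α ≠ 0 := by
  rw [← norm_pos_iff, norm_vHalf]
  exact one_pos

theorem continuous_vHalf : Continuous vHalf := by
  refine (PiLp.continuous_toLp 2 _).comp (continuous_pi fun i => ?_)
  fin_cases i <;> simp <;> fun_prop

theorem measurable_projAngle : Measurable projAngle := by
  unfold projAngle
  refine Measurable.fract (Measurable.div_const (Complex.measurable_arg.comp ?_) _)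
  have (i : Fin 2) : Continuous fun w : R2 => w i := by fun_prop
  exact Continuous.measurable (by fun_prop)

theorem eq_smul_vHalf_projAngle (w : R2) :
    ∃ s : ℝ, |s| = ‖w‖ ∧ w = s • vHalf (projAngle w) := by
  set z : ℂ := Complex.ofReal (w 0) + Complex.ofReal (w 1) * Complex.I with hz
  have hre : w 0 = ‖z‖ * Real.cos z.arg := by
    rw [Complex.norm_mul_cos_arg]; simp [hz]
  have him : w 1 = ‖z‖ * Real.sin z.arg := by
    rw [Complex.norm_mul_sin_arg]; simp [hz]
  have hnorm : ‖w‖ = ‖z‖ := by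
    rw [EuclideanSpace.norm_eq, Complex.norm_def, Complex.normSq_apply]
    simp [hz, Fin.sum_univ_two, sq]
  have hangle : Real.pi * projAngle w = z.arg - ⌊z.arg / Real.pi⌋ * Real.pi := by
    rw [projAngle, Int.fract, ← hz]
    field_simp
  set k := ⌊z.arg / Real.pi⌋
  have hk : ((-1 : ℝ) ^ k) * (-1) ^ k = 1 := by
    rw [← mul_zpow]; simp
  refine ⟨(-1) ^ k * ‖z‖, by simp [hnorm, abs_mul, abs_zpow], ?_⟩
  ext i
  fin_cases i
  · simp only [vHalf, hangle, Real.cos_sub_int_mul_pi, Real.sin_sub_int_mul_pi]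
    simp
    linear_combination hre - ‖z‖ * Real.cos z.arg * hk
  · simp only [vHalf, hangle, Real.cos_sub_int_mul_pi, Real.sin_sub_int_mul_pi]
    simp
    linear_combination him - ‖z‖ * Real.sin z.arg * hk

theorem projAngle_smul {c : ℝ} (hc : c ≠ 0) {w : R2} (hw : w ≠ 0) :
    projAngle (c • w) = projAngle w := by
  have hz : Complex.ofReal (w 0) + Complex.ofReal (w 1) * Complex.I ≠ 0 := by
    intro h
    apply hw
    rw [Complex.ext_iff] at h
    ext i
    fin_cases i
    · simpa using h.1
    · simpa using h.2
  have hcz : Complex.ofReal ((c • w) 0) + Complex.ofReal ((c • w) 1) * Complex.I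
      = c * (Complex.ofReal (w 0) + Complex.ofReal (w 1) * Complex.I) := by
    simp; ring
  rw [projAngle, projAngle, hcz]
  set z := Complex.ofReal (w 0) + Complex.ofReal (w 1) * Complex.I
  rcases hc.lt_or_gt with hneg | hpos
  · have harg : Complex.arg (c * z) = Complex.arg (-z) := by
      rw [← Complex.arg_real_mul (-z) (neg_pos.2 hneg)]
      simp
    have hang := Complex.arg_neg_coe_angle hz
    rw [← Real.Angle.coe_add, Real.Angle.angle_eq_iff_two_pi_dvd_sub] at hang
    obtain ⟨k, hk⟩ := hang
    have : Complex.arg (-z) / Real.pi = Complex.arg z / Real.pi + ((1 + 2 * k : ℤ) : ℝ) := by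
      push_cast
      field_simp
      linear_combination hk
    rw [harg, this, Int.fract_add_intCast]
  · rw [Complex.arg_real_mul z hpos]

/-! ### Existence of invariant measures -/

/-- The uniform probability measure on the first `n` points of the `G`-orbit of `x`. -/
def empiricalMeasure {X : Type*} [MeasurableSpace X] (G : X → X) (n : ℕ) (x : X) : Measure X :=
  (n : ENNReal)⁻¹ • ∑ i ∈ Finset.range n, Measure.dirac (G^[i] x)

theorem isProbabilityMeasure_empiricalMeasure {X : Type*} [MeasurableSpace X] (G : X → X)
    {n : ℕ} (hn : 0 < n) (x : X) : IsProbabilityMeasure (empiricalMeasure G n x) := by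
  constructor
  simp only [empiricalMeasure, Measure.smul_apply, Measure.finsetSum_apply, measure_univ,
    Finset.sum_const, Finset.card_range, nsmul_eq_mul, mul_one, smul_eq_mul]
  exact ENNReal.inv_mul_cancel (by exact_mod_cast hn.ne') (ENNReal.natCast_ne_top n)

theorem integral_empiricalMeasure {X : Type*} [TopologicalSpace X] [MeasurableSpace X]
    [OpensMeasurableSpace X] (G : X → X) (n : ℕ) (x : X) (f : BoundedContinuousFunction X ℝ) :
    ∫ y, f y ∂(empiricalMeasure G n x) = (n : ℝ)⁻¹ * ∑ i ∈ Finset.range n, f (G^[i] x) := by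
  rw [empiricalMeasure, integral_smul_measure,
    integral_finsetSum_measure fun i _ => f.integrable _]
  simp [integral_dirac' _ _ f.continuous.measurable.stronglyMeasurable]

theorem abs_integral_comp_sub_integral_empiricalMeasure_le {X : Type*} [TopologicalSpace X]
    [MeasurableSpace X] [OpensMeasurableSpace X] (G : C(X, X)) (n : ℕ) (x : X)
    (f : BoundedContinuousFunction X ℝ) :
    |∫ y, f.compContinuous G y ∂(empiricalMeasure G n x) - ∫ y, f y ∂(empiricalMeasure G n x)| ≤
      2 * ‖f‖ * (n : ℝ)⁻¹ := by
  rw [integral_empiricalMeasure, integral_empiricalMeasure, ← mul_sub, ← Finset.sum_sub_distrib]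
  simp only [BoundedContinuousFunction.compContinuous_apply, ← Function.iterate_succ_apply' G]
  rw [Finset.sum_range_sub fun i => f (G^[i] x), abs_mul, abs_of_nonneg (by positivity), mul_comm]
  gcongr
  calc |f (G^[n] x) - f (G^[0] x)| ≤ |f (G^[n] x)| + |f (G^[0] x)| := abs_sub _ _
    _ ≤ ‖f‖ + ‖f‖ := add_le_add (f.norm_coe_le_norm _) (f.norm_coe_le_norm _)
    _ = 2 * ‖f‖ := by ring

/-- **Krylov–Bogolyubov**: Birkhoff averages that are frequently at least `c` along some orbit
segments produce an invariant measure with integral at least `c`. -/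
theorem exists_measurePreserving_le_integral {X : Type*} [TopologicalSpace X] [CompactSpace X]
    [T2Space X] [MeasurableSpace X] [BorelSpace X] [HasOuterApproxClosed X]
    (G : C(X, X)) (φ : C(X, ℝ)) {c : ℝ}
    (hc : ∃ᶠ n : ℕ in atTop, ∃ x, c ≤ (n : ℝ)⁻¹ * ∑ i ∈ Finset.range n, φ (G^[i] x)) :
    ∃ ν : Measure X, IsProbabilityMeasure ν ∧ MeasurePreserving G ν ν ∧ c ≤ ∫ x, φ x ∂ν := by
  obtain ⟨k, hk, hkP⟩ := extraction_of_frequently_atTop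
    (hc.and_eventually (eventually_gt_atTop 0))
  choose y hy using fun j => (hkP j).1
  let μ (j : ℕ) : ProbabilityMeasure X :=
    ⟨empiricalMeasure G (k j) (y j), isProbabilityMeasure_empiricalMeasure G (hkP j).2 (y j)⟩
  let U : Ultrafilter ℕ := Ultrafilter.of atTop
  have hU : (U : Filter ℕ) ≤ atTop := Ultrafilter.of_le atTop
  have : Nonempty (ProbabilityMeasure X) := ⟨μ 0⟩
  obtain ⟨ν, hν⟩ : ∃ ν, Tendsto μ U (𝓝 ν) := ⟨_, (U.map μ).le_nhds_lim⟩
  rw [ProbabilityMeasure.tendsto_iff_forall_integral_tendsto] at hν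
  refine ⟨ν, inferInstance, ⟨G.continuous.measurable, ?_⟩, ?_⟩
  · have := Measure.isProbabilityMeasure_map (μ := (ν : Measure X))
      G.continuous.measurable.aemeasurable
    refine ext_of_forall_integral_eq_of_IsFiniteMeasure fun f => ?_
    rw [integral_map G.continuous.measurable.aemeasurable
      f.continuous.measurable.aestronglyMeasurable]
    rw [← sub_eq_zero]
    refine tendsto_nhds_unique ((hν (f.compContinuous G)).sub (hν f)) ?_
    have hinv : Tendsto (fun j => 2 * ‖f‖ * (k j : ℝ)⁻¹) U (𝓝 0) := by
      have := (tendsto_inv_atTop_nhds_zero_nat (𝕜 := ℝ)).comp (hk.tendsto_atTop.mono_left hU)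
      simpa using this.const_mul (2 * ‖f‖)
    exact squeeze_zero_norm
      (fun j => abs_integral_comp_sub_integral_empiricalMeasure_le G (k j) (y j) f) hinv
  · refine ge_of_tendsto (hν (BoundedContinuousFunction.mkOfCompact φ))
      (Eventually.of_forall fun j => ?_)
    exact (hy j).trans_eq
      (integral_empiricalMeasure G (k j) (y j) (BoundedContinuousFunction.mkOfCompact φ)).symm

/-! ### The cocycle and its projective action -/

section Cocycle

variable {Θ : Type*} {γ : Θ → Θ} {A : Θ → Matrix (Fin 2) (Fin 2) ℝ}

theorem det_coc (hdet : ∀ θ, (A θ).det = 1) (n : ℕ) (θ : Θ) : (coc γ A n θ).det = 1 := by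
  induction n generalizing θ with
  | zero => simp [coc]
  | succ n ih => simp [coc, ih, hdet]

theorem continuous_coc [TopologicalSpace Θ] (hγ : Continuous γ) (hA : Continuous A) (n : ℕ) :
    Continuous (coc γ A n) := by
  induction n with
  | zero => exact continuous_const
  | succ n ih => exact (ih.comp hγ).mul hA

theorem opNorm_mul_le (M N : Matrix (Fin 2) (Fin 2) ℝ) :
    opNorm (M * N) ≤ opNorm M * opNorm N := by
  unfold opNorm
  rw [map_mul]
  exact norm_mul_le _ _

theorem log_opNorm_coc_le (hdet : ∀ θ, (A θ).det = 1) {C : ℝ}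
    (hC : ∀ θ, Real.log (opNorm (A θ)) ≤ C) (n : ℕ) (θ : Θ) :
    Real.log (opNorm (coc γ A n θ)) ≤ n * C := by
  induction n generalizing θ with
  | zero => simp [coc, opNorm]
  | succ n ih =>
    have h1 := one_le_opNorm_of_det_eq_one (det_coc (γ := γ) hdet n (γ θ))
    have h2 := one_le_opNorm_of_det_eq_one (hdet θ)
    have h3 := one_le_opNorm_of_det_eq_one (det_coc (γ := γ) hdet (n + 1) θ)
    calc Real.log (opNorm (coc γ A (n + 1) θ))
        ≤ Real.log (opNorm (coc γ A n (γ θ)) * opNorm (A θ)) :=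
          Real.log_le_log (by linarith) (opNorm_mul_le _ _)
      _ = Real.log (opNorm (coc γ A n (γ θ))) + Real.log (opNorm (A θ)) :=
          Real.log_mul (by linarith) (by linarith)
      _ ≤ n * C + C := add_le_add (ih _) (hC θ)
      _ = (n + 1 : ℕ) * C := by push_cast; ring

theorem log_opNorm_coc_div_mem_Icc (hdet : ∀ θ, (A θ).det = 1) {C : ℝ}
    (hC : ∀ θ, Real.log (opNorm (A θ)) ≤ C) (n : ℕ) (θ : Θ) :
    Real.log (opNorm (coc γ A n θ)) / n ∈ Set.Icc 0 C := by
  refine ⟨div_nonneg (Real.log_nonneg (one_le_opNorm_of_det_eq_one (det_coc hdet n θ)))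
    n.cast_nonneg, ?_⟩
  have hC0 : 0 ≤ C := (Real.log_nonneg (one_le_opNorm_of_det_eq_one (hdet θ))).trans (hC θ)
  exact div_le_of_le_mul₀ n.cast_nonneg hC0
    ((log_opNorm_coc_le hdet hC n θ).trans_eq (mul_comm _ _))

theorem abs_log_norm_mulVecE_le {M : Matrix (Fin 2) (Fin 2) ℝ} (hM : M.det = 1) {v : R2}
    (hv : ‖v‖ = 1) : |Real.log ‖mulVecE M v‖| ≤ Real.log (opNorm M) := by
  have h1 := norm_le_opNorm_mul_of_det_eq_one hM v
  have h2 := norm_mulVecE_le M v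
  rw [hv] at h1
  rw [hv, mul_one] at h2
  have h3 : 0 < opNorm M := one_pos.trans_le (one_le_opNorm_of_det_eq_one hM)
  have h4 : 0 < ‖mulVecE M v‖ := pos_of_mul_pos_right (one_pos.trans_le h1) h3.le
  rw [abs_le]
  refine ⟨?_, Real.log_le_log h4 h2⟩
  have := Real.log_le_log one_pos h1
  rw [Real.log_one, Real.log_mul h3.ne' h4.ne'] at this
  linarith

theorem sum_log_Omega_iterate (hdet : ∀ θ, (A θ).det = 1) (n : ℕ) (p : Θ × ℝ) :
    ∑ i ∈ Finset.range n, Real.log (Omega A ((gMap γ A)^[i] p)) =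
      Real.log ‖mulVecE (coc γ A n p.1) (vHalf p.2)‖ := by
  induction n generalizing p with
  | zero => simp [coc, mulVecE_eq, norm_vHalf]
  | succ n ih =>
    obtain ⟨s, hs, hw⟩ := eq_smul_vHalf_projAngle (mulVecE (A p.1) (vHalf p.2))
    have hA0 := norm_ne_zero_iff.2 (mulVecE_ne_zero (hdet p.1) (vHalf_ne_zero p.2))
    have hn0 := norm_ne_zero_iff.2 (mulVecE_ne_zero (det_coc (γ := γ) hdet n (γ p.1))
      (vHalf_ne_zero (projAngle (mulVecE (A p.1) (vHalf p.2)))))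
    rw [Finset.sum_range_succ']
    simp only [Function.iterate_succ_apply, ih, Function.iterate_zero_apply]
    rw [coc, mulVecE_mul]
    conv_rhs => rw [hw]
    rw [mulVecE_smul, norm_smul, Real.norm_eq_abs, hs, Real.log_mul hA0 hn0, add_comm]
    rfl

theorem gMap_projAngle (hdet : ∀ θ, (A θ).det = 1) (θ : Θ) {v : R2} (hv : v ≠ 0) {c : ℝ}
    (hc : c ≠ 0) :
    gMap γ A (θ, projAngle v) = (γ θ, projAngle (c • mulVecE (A θ) v)) := by
  obtain ⟨s, -, hs⟩ := eq_smul_vHalf_projAngle v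
  have hs0 : s ≠ 0 := by
    rintro rfl
    exact hv (by simpa using hs)
  conv_rhs => rw [hs]
  rw [mulVecE_smul, smul_smul, projAngle_smul (mul_ne_zero hc hs0)
    (mulVecE_ne_zero (hdet θ) (vHalf_ne_zero _))]
  rfl

theorem norm_mulVecE_vHalf_projAngle (M : Matrix (Fin 2) (Fin 2) ℝ) {v : R2} (hv : ‖v‖ = 1) :
    ‖mulVecE M (vHalf (projAngle v))‖ = ‖mulVecE M v‖ := by
  obtain ⟨s, hs, hw⟩ := eq_smul_vHalf_projAngle v
  conv_rhs => rw [hw]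
  rw [mulVecE_smul, norm_smul, Real.norm_eq_abs, hs, hv, one_mul]

theorem continuous_mulVecE [TopologicalSpace Θ] (hA : Continuous A) :
    Continuous fun p : Θ × R2 => mulVecE (A p.1) p.2 :=
  ((continuous_toEuclideanCLM.comp hA).comp continuous_fst).clm_apply continuous_snd

theorem continuous_Omega [TopologicalSpace Θ] (hA : Continuous A) : Continuous (Omega A) :=
  ((continuous_mulVecE hA).comp
    (continuous_fst.prodMk (continuous_vHalf.comp continuous_snd))).norm

theorem measurable_gMap [TopologicalSpace Θ] [SecondCountableTopology Θ] [MeasurableSpace Θ]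
    [BorelSpace Θ] (hγ : Continuous γ) (hA : Continuous A) : Measurable (gMap γ A) := by
  refine (hγ.measurable.comp measurable_fst).prodMk (measurable_projAngle.comp ?_)
  exact ((continuous_mulVecE hA).comp
    (continuous_fst.prodMk (continuous_vHalf.comp continuous_snd))).measurable

/-- The action of the cocycle on the unit circle bundle, a double cover of the projective
action. -/
def sphereMap [TopologicalSpace Θ] (hγ : Continuous γ) (hA : Continuous A)
    (hdet : ∀ θ, (A θ).det = 1) :
    C(Θ × Metric.sphere (0 : R2) 1, Θ × Metric.sphere (0 : R2) 1) where
  toFun p := (γ p.1, ⟨‖mulVecE (A p.1) p.2‖⁻¹ • mulVecE (A p.1) p.2, by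
    have := norm_ne_zero_iff.2 (mulVecE_ne_zero (hdet p.1) (ne_zero_of_mem_unit_sphere p.2))
    rw [mem_sphere_zero_iff_norm, norm_smul, norm_inv, norm_norm, inv_mul_cancel₀ this]⟩)
  continuous_toFun := by
    have hc : Continuous fun p : Θ × Metric.sphere (0 : R2) 1 => mulVecE (A p.1) p.2 :=
      (continuous_mulVecE hA).comp
        (continuous_fst.prodMk (continuous_subtype_val.comp continuous_snd))
    refine (hγ.comp continuous_fst).prodMk (Continuous.subtype_mk ?_ _)
    exact (hc.norm.inv₀ fun p => norm_ne_zero_iff.2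
      (mulVecE_ne_zero (hdet p.1) (ne_zero_of_mem_unit_sphere p.2))).smul hc

/-- The projection from the unit circle bundle to the projective bundle. -/
def sphereProj (p : Θ × Metric.sphere (0 : R2) 1) : Θ × ℝ := (p.1, projAngle p.2)

theorem Omega_sphereProj (p : Θ × Metric.sphere (0 : R2) 1) :
    Omega A (sphereProj p) = ‖mulVecE (A p.1) p.2‖ :=
  norm_mulVecE_vHalf_projAngle _ (by simp)

theorem semiconj_sphereProj [TopologicalSpace Θ] (hγ : Continuous γ) (hA : Continuous A)
    (hdet : ∀ θ, (A θ).det = 1) :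
    Function.Semiconj sphereProj (sphereMap hγ hA hdet) (gMap γ A) := fun p =>
  (gMap_projAngle hdet p.1 (ne_zero_of_mem_unit_sphere p.2) (inv_ne_zero (norm_ne_zero_iff.2
    (mulVecE_ne_zero (hdet p.1) (ne_zero_of_mem_unit_sphere p.2))))).symm

theorem measurable_sphereProj [MeasurableSpace Θ] :
    Measurable (sphereProj : Θ × Metric.sphere (0 : R2) 1 → Θ × ℝ) :=
  measurable_fst.prodMk (measurable_projAngle.comp (measurable_subtype_coe.comp measurable_snd))

end Cocycle

/-! ### Exponents of invariant measures -/

section Exponent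

variable {Θ : Type*} [MetricSpace Θ] [CompactSpace Θ]
  {γ : Θ → Θ} {A : Θ → Matrix (Fin 2) (Fin 2) ℝ}

theorem exists_forall_log_opNorm_le (hdet : ∀ θ, (A θ).det = 1) (hA : Continuous A) :
    ∃ C, ∀ θ, Real.log (opNorm (A θ)) ≤ C := by
  have hc : Continuous fun θ => Real.log (opNorm (A θ)) :=
    (continuous_opNorm.comp hA).log fun θ =>
      (one_pos.trans_le (one_le_opNorm_of_det_eq_one (hdet θ))).ne'
  obtain ⟨C, hC⟩ := (isCompact_range hc).bddAbove
  exact ⟨C, fun θ => hC (mem_range_self θ)⟩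

theorem limsup_log_opNorm_coc_le_lyapMax (hdet : ∀ θ, (A θ).det = 1) (hA : Continuous A) (θ : Θ) :
    limsup (fun n : ℕ => Real.log (opNorm (coc γ A n θ)) / n) atTop ≤ lyapMax γ A := by
  obtain ⟨C, hC⟩ := exists_forall_log_opNorm_le hdet hA
  refine le_ciSup (f := fun θ => limsup
    (fun n : ℕ => Real.log (opNorm (coc γ A n θ)) / n) atTop) ⟨C, ?_⟩ θ
  rintro _ ⟨θ', rfl⟩
  exact limsup_le_of_le
    (isBoundedUnder_of ⟨0, fun n => (log_opNorm_coc_div_mem_Icc hdet hC n θ').1⟩).isCoboundedUnder_le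
    (Eventually.of_forall fun n => (log_opNorm_coc_div_mem_Icc hdet hC n θ').2)

theorem frequently_lt_log_opNorm_coc_of_lt_lyapMax [Nonempty Θ] (hdet : ∀ θ, (A θ).det = 1)
    (hA : Continuous A) {c : ℝ} (hc : c < lyapMax γ A) :
    ∃ θ, ∃ᶠ n : ℕ in atTop, c < Real.log (opNorm (coc γ A n θ)) / n := by
  obtain ⟨C, hC⟩ := exists_forall_log_opNorm_le hdet hA
  obtain ⟨θ, hθ⟩ := exists_lt_of_lt_ciSup hc
  exact ⟨θ, frequently_lt_of_lt_limsup (isBoundedUnder_of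
    ⟨0, fun n => (log_opNorm_coc_div_mem_Icc hdet hC n θ).1⟩).isCoboundedUnder_le hθ⟩

variable [MeasurableSpace Θ] [BorelSpace Θ]

theorem integrable_log_Omega (hdet : ∀ θ, (A θ).det = 1) (hA : Continuous A)
    (μ : Measure (Θ × ℝ)) [IsFiniteMeasure μ] : Integrable (fun p => Real.log (Omega A p)) μ := by
  obtain ⟨C, hC⟩ := exists_forall_log_opNorm_le hdet hA
  refine Integrable.of_bound (C := C) ?_ (Eventually.of_forall fun p =>
    (abs_log_norm_mulVecE_le (hdet p.1) (norm_vHalf p.2)).trans (hC p.1))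
  exact (continuous_Omega hA).measurable.log.aestronglyMeasurable

theorem abs_integral_log_Omega_le_integral (hγ : Continuous γ) (hdet : ∀ θ, (A θ).det = 1)
    (hA : Continuous A)
    {μ : Measure (Θ × ℝ)} [IsProbabilityMeasure μ] (hμ : MeasurePreserving (gMap γ A) μ μ)
    {n : ℕ} (hn : 0 < n) :
    |∫ p, Real.log (Omega A p) ∂μ| ≤ ∫ p, Real.log (opNorm (coc γ A n p.1)) / n ∂μ := by
  obtain ⟨C, hC⟩ := exists_forall_log_opNorm_le hdet hA
  have hint := integrable_log_Omega hdet hA μ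
  have hiter (i : ℕ) : ∫ p, Real.log (Omega A ((gMap γ A)^[i] p)) ∂μ =
      ∫ p, Real.log (Omega A p) ∂μ := by
    have hi := hμ.iterate i
    rw [← integral_map (f := fun p => Real.log (Omega A p)) hi.measurable.aemeasurable
      (by rw [hi.map_eq]; exact hint.aestronglyMeasurable), hi.map_eq]
  have hsum : ∫ p, Real.log (Omega A p) ∂μ =
      ∫ p, Real.log ‖mulVecE (coc γ A n p.1) (vHalf p.2)‖ / n ∂μ := by
    rw [integral_div]
    simp_rw [← sum_log_Omega_iterate hdet]
    rw [integral_finsetSum (f := fun i p => Real.log (Omega A ((gMap γ A)^[i] p))) _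
      fun i _ => (hμ.iterate i).integrable_comp_of_integrable hint]
    simp_rw [hiter]
    rw [Finset.sum_const, Finset.card_range, nsmul_eq_mul]
    field_simp
  rw [hsum]
  refine (abs_integral_le_integral_abs).trans (integral_mono_of_nonneg
    (Eventually.of_forall fun p => abs_nonneg _) ?_ (Eventually.of_forall fun p => ?_))
  · refine Integrable.of_bound (C := C) ?_ (Eventually.of_forall fun p => ?_)
    · exact (((continuous_opNorm.comp ((continuous_coc hγ hA n).comp
        continuous_fst)).measurable.log).div_const _).aestronglyMeasurable
    · have := log_opNorm_coc_div_mem_Icc (γ := γ) hdet hC n p.1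
      rw [Real.norm_of_nonneg this.1]
      exact this.2
  · simp only [abs_div, Nat.abs_cast]
    gcongr
    exact abs_log_norm_mulVecE_le (det_coc hdet n p.1) (norm_vHalf p.2)

theorem abs_integral_log_Omega_le_lyapMax (hγ : Continuous γ) (hdet : ∀ θ, (A θ).det = 1)
    (hA : Continuous A)
    {μ : Measure (Θ × ℝ)} [IsProbabilityMeasure μ] (hμ : MeasurePreserving (gMap γ A) μ μ) :
    |∫ p, Real.log (Omega A p) ∂μ| ≤ lyapMax γ A := by
  obtain ⟨C, hC⟩ := exists_forall_log_opNorm_le hdet hA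
  refine le_of_forall_pos_le_add fun ε hε => ?_
  set L := lyapMax γ A + ε
  let u (n : ℕ) (p : Θ × ℝ) : ℝ := Real.log (opNorm (coc γ A n p.1)) / n
  have hu (n : ℕ) (p : Θ × ℝ) : u n p ∈ Set.Icc 0 C := log_opNorm_coc_div_mem_Icc hdet hC n p.1
  have hum (n : ℕ) : Measurable (u n) := ((continuous_opNorm.comp ((continuous_coc hγ hA n).comp
        continuous_fst)).measurable.log).div_const _
  have hui (n : ℕ) : Integrable (u n) μ :=
    Integrable.of_bound (C := C) (hum n).aestronglyMeasurable (Eventually.of_forall fun p => by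
      rw [Real.norm_of_nonneg (hu n p).1]; exact (hu n p).2)
  have hmaxm (n : ℕ) : AEStronglyMeasurable (fun p => max (u n p - L) 0) μ :=
    (((hum n).sub_const L).max measurable_const).aestronglyMeasurable
  have hbound (n : ℕ) (p : Θ × ℝ) : ‖max (u n p - L) 0‖ ≤ C + |L| := by
    rw [Real.norm_of_nonneg (le_max_right _ _)]
    have := hu n p
    exact max_le (by linarith [this.2, neg_abs_le L]) (by linarith [this.1, this.2, abs_nonneg L])
  have hlim : Tendsto (fun n => ∫ p, max (u n p - L) 0 ∂μ) atTop (𝓝 (∫ _, (0 : ℝ) ∂μ)) := by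
    refine tendsto_integral_of_dominated_convergence (fun _ => C + |L|) hmaxm
      (integrable_const _) (fun n => Eventually.of_forall (hbound n))
      (Eventually.of_forall fun p => ?_)
    refine tendsto_const_nhds.congr' ?_
    have hlt : limsup (fun n => u n p) atTop < L :=
      (limsup_log_opNorm_coc_le_lyapMax hdet hA p.1).trans_lt (lt_add_of_pos_right _ hε)
    filter_upwards [eventually_lt_of_limsup_lt hlt (isBoundedUnder_of ⟨C, fun n => (hu n p).2⟩)]
      with n hn
    exact (max_eq_right (sub_nonpos.2 hn.le)).symm
  rw [integral_zero] at hlim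
  rw [← sub_nonpos]
  refine ge_of_tendsto hlim ((eventually_gt_atTop 0).mono fun n hn => ?_)
  calc |∫ p, Real.log (Omega A p) ∂μ| - L ≤ ∫ p, u n p ∂μ - L := by
        gcongr
        exact abs_integral_log_Omega_le_integral hγ hdet hA hμ hn
    _ = ∫ p, (u n p - L) ∂μ := by
        rw [integral_sub (hui n) (integrable_const _)]; simp
    _ ≤ ∫ p, max (u n p - L) 0 ∂μ :=
        integral_mono ((hui n).sub (integrable_const _))
          (Integrable.of_bound (hmaxm n) (C + |L|) (Eventually.of_forall (hbound n)))
          fun p => le_max_left _ _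

/-- A sign choice `σ = ±1` treats expanding and contracting directions simultaneously. -/
theorem exists_measurePreserving_gMap_le_integral (hγ : Continuous γ)
    (hdet : ∀ θ, (A θ).det = 1) (hA : Continuous A) {c σ : ℝ}
    (hc : ∃ᶠ n : ℕ in atTop, ∃ (θ : Θ) (v : R2), ‖v‖ = 1 ∧
      c ≤ σ * (Real.log ‖mulVecE (coc γ A n θ) v‖ / n)) :
    ∃ μ : Measure (Θ × ℝ), IsProbabilityMeasure μ ∧ MeasurePreserving (gMap γ A) μ μ ∧
      c ≤ σ * ∫ p, Real.log (Omega A p) ∂μ := by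
  let φ : C(Θ × Metric.sphere (0 : R2) 1, ℝ) :=
    ⟨fun p => σ * Real.log ‖mulVecE (A p.1) p.2‖, by
      refine continuous_const.mul (Continuous.log ?_ fun p => norm_ne_zero_iff.2
        (mulVecE_ne_zero (hdet p.1) (ne_zero_of_mem_unit_sphere p.2)))
      exact ((continuous_mulVecE hA).comp
        (continuous_fst.prodMk (continuous_subtype_val.comp continuous_snd))).norm⟩
  have hφ (p) : φ p = σ * Real.log (Omega A (sphereProj p)) := by rw [Omega_sphereProj]; rfl
  obtain ⟨ν, hν, hinv, hle⟩ := exists_measurePreserving_le_integral (sphereMap hγ hA hdet) φ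
    (c := c) <| hc.mono <| by
      rintro n ⟨θ, v, hv, hle⟩
      refine ⟨(θ, ⟨v, by simpa using hv⟩), hle.trans_eq ?_⟩
      simp_rw [hφ, ((semiconj_sphereProj hγ hA hdet).iterate_right _).eq]
      rw [← Finset.mul_sum, sum_log_Omega_iterate hdet]
      simp only [sphereProj, norm_mulVecE_vHalf_projAngle _ hv]
      ring
  have hm := measurable_sphereProj (Θ := Θ)
  refine ⟨ν.map sphereProj, Measure.isProbabilityMeasure_map hm.aemeasurable,
    ⟨measurable_gMap hγ hA, ?_⟩, ?_⟩
  · rw [Measure.map_map (measurable_gMap hγ hA) hm, ← (semiconj_sphereProj hγ hA hdet).comp_eq,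
      ← Measure.map_map hm hinv.measurable, hinv.map_eq]
  · rw [integral_map hm.aemeasurable (continuous_Omega hA).measurable.log.aestronglyMeasurable,
      ← integral_const_mul]
    simpa only [hφ] using hle

theorem exists_measurePreserving_le_integral_log_Omega [Nonempty Θ] (hγ : Continuous γ)
    (hdet : ∀ θ, (A θ).det = 1) (hA : Continuous A) {c : ℝ} (hc : c < lyapMax γ A) :
    ∃ μ : Measure (Θ × ℝ), IsProbabilityMeasure μ ∧ MeasurePreserving (gMap γ A) μ μ ∧
      c ≤ ∫ p, Real.log (Omega A p) ∂μ := by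
  obtain ⟨θ, hθ⟩ := frequently_lt_log_opNorm_coc_of_lt_lyapMax hdet hA hc
  simpa using exists_measurePreserving_gMap_le_integral (σ := 1) hγ hdet hA <|
    hθ.mono fun n hn => by
      obtain ⟨v, hv, hv'⟩ := exists_norm_mulVecE_eq_opNorm (coc γ A n θ)
      exact ⟨θ, v, hv, by rw [hv', one_mul]; exact hn.le⟩

theorem exists_measurePreserving_integral_log_Omega_le [Nonempty Θ] (hγ : Continuous γ)
    (hdet : ∀ θ, (A θ).det = 1) (hA : Continuous A) {c : ℝ} (hc : c < lyapMax γ A) :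
    ∃ μ : Measure (Θ × ℝ), IsProbabilityMeasure μ ∧ MeasurePreserving (gMap γ A) μ μ ∧
      ∫ p, Real.log (Omega A p) ∂μ ≤ -c := by
  obtain ⟨θ, hθ⟩ := frequently_lt_log_opNorm_coc_of_lt_lyapMax hdet hA hc
  obtain ⟨μ, h1, h2, h3⟩ := exists_measurePreserving_gMap_le_integral (σ := -1) hγ hdet hA <|
    hθ.mono fun n hn => by
      have hdn := det_coc (γ := γ) hdet n θ
      obtain ⟨v, hv, hv'⟩ := exists_opNorm_mul_norm_mulVecE_le hdn
      refine ⟨θ, v, hv, hn.le.trans ?_⟩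
      have hpos : 0 < opNorm (coc γ A n θ) := one_pos.trans_le (one_le_opNorm_of_det_eq_one hdn)
      have hv0 : 0 < ‖mulVecE (coc γ A n θ) v‖ :=
        norm_pos_iff.2 (mulVecE_ne_zero hdn (norm_ne_zero_iff.1 (by simp [hv])))
      have hlog := Real.log_nonpos (by positivity) hv'
      rw [Real.log_mul hpos.ne' hv0.ne'] at hlog
      rw [neg_one_mul, ← neg_div]
      gcongr
      linarith
  exact ⟨μ, h1, h2, by linarith⟩

end Exponent

/-- `β₁ = e^{-λ_max(A)}` is the supremum of the β > 0 with
`λ_μ(F_β,0) < 0` for all g-invariant Borel probability measures μ on Θ×𝕋, and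
`β₂ = e^{λ_max(A)}` is the infimum of the β > 0 with `λ_μ(F_β,0) > 0` for all such μ.
Here `λ_μ(F_β,0) = log β + ∫ log Ω dμ`. -/
theorem stmt10 {Θ : Type*} [MetricSpace Θ] [CompactSpace Θ]
    [MeasurableSpace Θ] [BorelSpace Θ]
    (γ : Θ ≃ₜ Θ)
    (A : Θ → Matrix (Fin 2) (Fin 2) ℝ) (hdet : ∀ θ, (A θ).det = 1) (hA : Continuous A)
    (h : ℝ → ℝ) (hh : GoodH h) (hscale : Scaled A h) :
    Real.exp (-(lyapMax ⇑γ A)) =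
      sSup {β : ℝ | 0 < β ∧ ∀ μ : Measure (Θ × ℝ), IsProbabilityMeasure μ →
        MeasurePreserving (gMap ⇑γ A) μ μ →
        Real.log β + ∫ p, Real.log (Omega A p) ∂μ < 0} ∧
    Real.exp (lyapMax ⇑γ A) =
      sInf {β : ℝ | 0 < β ∧ ∀ μ : Measure (Θ × ℝ), IsProbabilityMeasure μ →
        MeasurePreserving (gMap ⇑γ A) μ μ →
        0 < Real.log β + ∫ p, Real.log (Omega A p) ∂μ} := by
  have hne : Nonempty Θ := by
    by_contra hempty
    rw [not_nonempty_iff] at hempty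
    have h1 := hscale 1 (mem_Ici.2 zero_le_one)
    rw [Real.iSup_of_isEmpty, inv_zero] at h1
    have h2 := hh.2.1 self_mem_Ici (mem_Ici.2 zero_le_one) zero_lt_one
    rw [hh.2.2.2.2.2.1] at h2
    exact h2.not_ge h1
  set L := lyapMax γ A
  have hbound {μ : Measure (Θ × ℝ)} (hμ : IsProbabilityMeasure μ)
      (hinv : MeasurePreserving (gMap γ A) μ μ) :=
    abs_le.1 (abs_integral_log_Omega_le_lyapMax γ.continuous hdet hA hinv)
  constructor
  · refine Eq.symm (IsLUB.csSup_eq ⟨?_, fun b hb => ?_⟩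
      ⟨Real.exp (-L - 1), Real.exp_pos _, fun μ hμ hinv => ?_⟩)
    · rintro β ⟨hβ, hneg⟩
      rw [← Real.log_le_iff_le_exp hβ]
      by_contra! hlt
      obtain ⟨μ, hμ, hinv, hle⟩ := exists_measurePreserving_le_integral_log_Omega
        γ.continuous hdet hA (c := -Real.log β) (by linarith)
      linarith [hneg μ hμ hinv]
    · refine le_of_forall_lt fun x hx => ?_
      obtain ⟨y, hy, hyL⟩ := exists_between (max_lt hx (Real.exp_pos (-L)))
      have hy0 : 0 < y := (le_max_right _ _).trans_lt hy
      refine ((le_max_left _ _).trans_lt hy).trans_le (hb ⟨hy0, fun μ hμ hinv => ?_⟩)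
      have := (Real.log_lt_iff_lt_exp hy0).2 hyL
      linarith [(hbound hμ hinv).2]
    · rw [Real.log_exp]
      linarith [(hbound hμ hinv).2]
  · refine Eq.symm (IsGLB.csInf_eq ⟨?_, fun b hb => ?_⟩
      ⟨Real.exp (L + 1), Real.exp_pos _, fun μ hμ hinv => ?_⟩)
    · rintro β ⟨hβ, hpos⟩
      rw [← Real.le_log_iff_exp_le hβ]
      by_contra! hlt
      obtain ⟨μ, hμ, hinv, hle⟩ := exists_measurePreserving_integral_log_Omega_le
        γ.continuous hdet hA hlt
      linarith [hpos μ hμ hinv]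
    · refine le_of_forall_gt fun y hy => ?_
      obtain ⟨z, hz, hzy⟩ := exists_between hy
      have hz0 : 0 < z := (Real.exp_pos L).trans hz
      refine (hb ⟨hz0, fun μ hμ hinv => ?_⟩).trans_lt hzy
      have := (Real.lt_log_iff_exp_lt hz0).2 hz
      linarith [(hbound hμ hinv).1]
    · rw [Real.log_exp]
      linarith [(hbound hμ hinv).1]
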